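/- arXiv:2212.03418 — 2 statements merged into one kernel-verified Lean document; each statement's English description precedes it below -/
import Mathlib

section
/- Let f, f₁, …, fₘ, g₁, …, gₘ be polynomials with algebraic complex coefficients and let α₁, …, αₘ be nonzero algebraic complex numbers. Suppose α is a nonzero complex number satisfying g₁(α)·e^{α₁·f₁(α)} + ⋯ + gₘ(α)·e^{αₘ·fₘ(α)} = f(α), such that the exponents α₁·f₁(α), …, αₘ·fₘ(α) are pairwise distinct and all nonzero, and the coefficients g₁(α), …, gₘ(α) are not all zero. Then α is transcendental. -/
section LindemannWeierstrass

open Polynomial Filter Topology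
open scoped Nat

theorem isIntegral_leadingCoeff_pow_smul_aeval {R A : Type*} [CommRing R] [CommRing A]
    [Algebra R A] {f : R[X]} {x : A} (hx : aeval x f = 0) (g : R[X]) {k : ℕ}
    (hk : g.natDegree ≤ k) : IsIntegral R (f.leadingCoeff ^ k • aeval x g) := by
  rw [aeval_eq_sum_range, Finset.smul_sum]
  refine IsIntegral.sum _ fun i hi => ?_
  have hik : i ≤ k := (Nat.lt_succ_iff.mp (Finset.mem_range.mp hi)).trans hk
  have key : f.leadingCoeff ^ k • g.coeff i • x ^ i =
      (f.leadingCoeff ^ (k - i) * g.coeff i) • (f.leadingCoeff • x) ^ i := by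
    rw [_root_.smul_pow, smul_smul, smul_smul]
    congr 1
    rw [← Nat.sub_add_cancel hik, pow_add, Nat.sub_add_cancel hik]
    ring
  rw [key]
  exact ((isIntegral_leadingCoeff_smul f x hx).pow i).smul _

theorem exists_int_polynomial_eval_zero_ne_zero {K : Type*} [Field K] [CharZero K]
    (s : Finset K) (hs : ∀ x ∈ s, IsAlgebraic ℤ x) (h0 : (0 : K) ∉ s) :
    ∃ f : ℤ[X], f.eval 0 ≠ 0 ∧ ∀ x ∈ s, aeval x f = 0 := by
  have h : ∀ x : s, ∃ f : ℤ[X], f.coeff 0 ≠ 0 ∧ aeval (x : K) f = 0 := fun x =>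
    (hs x x.2).exists_nonzero_coeff_and_aeval_eq_zero
      (mem_nonZeroDivisors_of_ne_zero fun h => h0 (h ▸ x.2))
  choose f hf hfx using h
  refine ⟨∏ x, f x, ?_, fun x hx => ?_⟩
  · rw [eval_prod]
    exact Finset.prod_ne_zero_iff.mpr fun x _ => by
      rw [← coeff_zero_eq_eval_zero]; exact hf x
  · rw [map_prod]
    exact Finset.prod_eq_zero (Finset.mem_univ ⟨x, hx⟩) (hfx ⟨x, hx⟩)

theorem exists_intCast_eq_of_isIntegral_of_forall_algEquiv_eq {K : Type*} [Field K] [Algebra ℚ K]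
    [FiniteDimensional ℚ K] [IsGalois ℚ K] {x : K} (hx : IsIntegral ℤ x)
    (hfix : ∀ σ : K ≃ₐ[ℚ] K, σ x = x) : ∃ n : ℤ, x = n := by
  obtain ⟨q, rfl⟩ := (IsGalois.mem_range_algebraMap_iff_fixed x).mpr hfix
  obtain ⟨n, rfl⟩ := IsIntegrallyClosed.isIntegral_iff.mp
    ((isIntegral_algebraMap_iff (algebraMap ℚ K).injective).mp hx)
  exact ⟨n, by simp⟩

theorem eventually_mul_pow_div_factorial_pred_lt_one (B c : ℝ) :
    ∀ᶠ p : ℕ in atTop, B * (c ^ p / (p - 1)!) < 1 := by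
  have h := ((FloorSemiring.tendsto_pow_div_factorial_atTop c).const_mul (B * c))
  rw [mul_zero] at h
  filter_upwards [(tendsto_sub_atTop_nat 1).eventually (h.eventually_lt_const one_pos),
    eventually_ge_atTop 1] with p hp hp1
  obtain ⟨q, rfl⟩ := Nat.exists_eq_add_of_le' hp1
  rw [Nat.add_sub_cancel] at hp ⊢
  rwa [pow_succ', mul_div_assoc, ← mul_assoc]

/-- The Galois-invariant, integral case of Lindemann–Weierstrass: a finite sum of exponentials whose
integral coefficients are compatible with the Galois action, and whose constant term is a nonzero
integer, does not vanish. -/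
theorem sum_mul_cexp_ne_zero_of_isIntegral {K : Type*} [Field K] [Algebra ℚ K]
    [FiniteDimensional ℚ K] [IsGalois ℚ K] [Algebra K ℂ] (w : K →₀ K)
    (hint : ∀ x, IsIntegral ℤ (w x)) (hgal : ∀ (σ : K ≃ₐ[ℚ] K) x, w (σ x) = σ (w x))
    {b : ℤ} (hb : b ≠ 0) (hw : w 0 = b) :
    w.sum (fun x c => algebraMap K ℂ c * Complex.exp (algebraMap K ℂ x)) ≠ 0 := by
  classical
  intro hzero
  have : CharZero K := charZero_of_injective_algebraMap (algebraMap ℚ K).injective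
  set s := w.support.erase 0 with hs
  obtain ⟨f, hf0, hfs⟩ := exists_int_polynomial_eval_zero_ne_zero s
    (fun x _ => (IsFractionRing.isAlgebraic_iff ℤ ℚ K).mpr (IsAlgebraic.of_finite ℚ x)) (by simp [hs])
  obtain ⟨c, hc⟩ := LindemannWeierstrass.exp_polynomial_approx f hf0
  have hf : f ≠ 0 := by rintro rfl; simp at hf0
  set L := f.leadingCoeff
  have hL0 : L ≠ 0 := leadingCoeff_ne_zero.mpr hf
  set d := f.natDegree
  set ι := algebraMap K ℂ
  set B : ℝ := ∑ x ∈ s, ‖ι (w x)‖ with hB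
  have hsum : (b : ℂ) + ∑ x ∈ s, ι (w x) * Complex.exp (ι x) = 0 := by
    rw [← hzero, Finsupp.sum, ← Finset.add_sum_erase _ _ (show (0 : K) ∈ w.support by
      rw [Finsupp.mem_support_iff, hw]; exact_mod_cast hb), hw]
    simp [ι, hs]
  obtain ⟨p, hp, hpp⟩ : ∃ p : ℕ, (f.eval 0).natAbs < p ∧ b.natAbs < p ∧ L.natAbs < p ∧
      B * ((|(L : ℝ)| ^ d * c) ^ p / (p - 1)!) < 1 ∧ p.Prime := by
    obtain ⟨N, hN⟩ := eventually_atTop.mp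
      (eventually_mul_pow_div_factorial_pred_lt_one B (|(L : ℝ)| ^ d * c))
    obtain ⟨p, hp, hpp⟩ := Nat.exists_infinite_primes
      (N + (f.eval 0).natAbs + b.natAbs + L.natAbs + 1)
    exact ⟨p, by omega, by omega, by omega, hN p (by omega), hpp⟩
  obtain ⟨hpb, hpL, hsmall, hprime⟩ := hpp
  obtain ⟨n, hn, g, hg, happ⟩ := hc p hp hprime
  obtain ⟨T, hT⟩ : ∃ T : ℤ, L ^ (p * d) • ∑ x ∈ s, w x * aeval x g = (T : K) := by
    refine exists_intCast_eq_of_isIntegral_of_forall_algEquiv_eq ?_ fun σ => ?_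
    · rw [Finset.smul_sum]
      refine IsIntegral.sum _ fun x hx => ?_
      rw [← mul_smul_comm]
      exact (hint x).mul (isIntegral_leadingCoeff_pow_smul_aeval (hfs x hx) g (by omega))
    · rw [map_zsmul, map_sum]
      congr 1
      refine Finset.sum_equiv σ.toEquiv (fun x => ?_) fun x _ => ?_
      · simp [hs, hgal]
      · simp only [AlgEquiv.toEquiv_eq_coe, EquivLike.coe_coe, map_mul, hgal]
        congr 1
        exact (aeval_algHom_apply (σ : K →+* K).toIntAlgHom x g).symm
  have hTC : (L : ℂ) ^ (p * d) * ∑ x ∈ s, ι (w x) * aeval (ι x) g = T := by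
    have := congrArg ι hT
    simpa [zsmul_eq_mul, aeval_algebraMap_apply, ι] using this
  have hM : ((L ^ (p * d) * (n * b) + p * T : ℤ) : ℂ) =
      -(L : ℂ) ^ (p * d) * ∑ x ∈ s, ι (w x) * (n • Complex.exp (ι x) - p • aeval (ι x) g) := by
    push_cast
    rw [← hTC, eq_neg_of_add_eq_zero_left hsum]
    simp only [mul_sub, Finset.sum_sub_distrib, Finset.mul_sum, zsmul_eq_mul, nsmul_eq_mul,
      Finset.sum_neg_distrib, mul_neg, neg_mul]
    rw [sub_neg_eq_add]
    congr 1
    · congr 1; exact Finset.sum_congr rfl fun x _ => by ring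
    · exact Finset.sum_congr rfl fun x _ => by ring
  have hne : L ^ (p * d) * (n * b) + p * T ≠ 0 := by
    intro h
    have hpI : Prime (p : ℤ) := Nat.prime_iff_prime_int.mp hprime
    have hlt : ∀ z : ℤ, z ≠ 0 → z.natAbs < p → ¬ (p : ℤ) ∣ z := fun z hz hzp hdvd =>
      hzp.not_ge (Nat.le_of_dvd (Int.natAbs_pos.mpr hz) (Int.natCast_dvd.mp hdvd))
    have hdvd : (p : ℤ) ∣ L ^ (p * d) * (n * b) :=
      (dvd_add_left (dvd_mul_right _ T)).mp (h ▸ dvd_zero _)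
    rcases hpI.dvd_or_dvd hdvd with h | h
    · exact hlt L hL0 hpL (hpI.dvd_of_dvd_pow h)
    · exact (hpI.dvd_or_dvd h).elim hn (hlt b hb hpb)
  have hbound : ‖((L ^ (p * d) * (n * b) + p * T : ℤ) : ℂ)‖ < 1 := by
    rw [hM, norm_mul, norm_neg, norm_pow, Complex.norm_intCast]
    calc |(L : ℝ)| ^ (p * d) *
          ‖∑ x ∈ s, ι (w x) * (n • Complex.exp (ι x) - p • aeval (ι x) g)‖
        ≤ |(L : ℝ)| ^ (p * d) * ∑ x ∈ s, ‖ι (w x)‖ * (c ^ p / (p - 1)!) := by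
          gcongr
          refine norm_sum_le_of_le _ fun x hx => ?_
          rw [norm_mul]
          gcongr
          refine happ ((mem_aroots).mpr ⟨hf, ?_⟩)
          rw [aeval_algebraMap_apply, hfs x hx, map_zero]
      _ = B * ((|(L : ℝ)| ^ d * c) ^ p / (p - 1)!) := by
          rw [← Finset.sum_mul, ← hB, mul_pow, ← pow_mul, mul_comm d p]; ring
      _ < 1 := hsmall
  rw [Complex.norm_intCast] at hbound
  exact hne (Int.abs_lt_one_iff.mp (by exact_mod_cast hbound))

/-- The ring automorphism of the group algebra `K[K]` induced by a field automorphism, acting on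
both the coefficients and the exponents. -/
noncomputable def galoisConj {K : Type*} [Field K] [Algebra ℚ K] (σ : K ≃ₐ[ℚ] K) :
    AddMonoidAlgebra K K →+* AddMonoidAlgebra K K :=
  (AddMonoidAlgebra.mapDomainRingHom K (σ : K →+ K)).comp
    (AddMonoidAlgebra.mapRingHom K (σ : K →+* K))

section galoisConj

variable {K : Type*} [Field K] [Algebra ℚ K]

theorem galoisConj_single (σ : K ≃ₐ[ℚ] K) (x c : K) :
    galoisConj σ (AddMonoidAlgebra.single x c) = AddMonoidAlgebra.single (σ x) (σ c) := by
  simp [galoisConj, AddMonoidAlgebra.mapDomainRingHom]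

theorem coeff_galoisConj_apply (σ : K ≃ₐ[ℚ] K) (z : AddMonoidAlgebra K K) (x : K) :
    (galoisConj σ z).coeff (σ x) = σ (z.coeff x) := by
  classical
  induction z using AddMonoidAlgebra.induction_linear with
  | zero => simp
  | add f g hf hg => simp [hf, hg]
  | single y c =>
    rw [galoisConj_single, AddMonoidAlgebra.coeff_single, AddMonoidAlgebra.coeff_single,
      Finsupp.single_apply, Finsupp.single_apply]
    simp only [EmbeddingLike.apply_eq_iff_eq]
    split_ifs <;> simp

theorem galoisConj_galoisConj (σ τ : K ≃ₐ[ℚ] K) (z : AddMonoidAlgebra K K) :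
    galoisConj σ (galoisConj τ z) = galoisConj (σ * τ) z := by
  induction z using AddMonoidAlgebra.induction_linear with
  | zero => simp
  | add f g hf hg => simp [hf, hg]
  | single y c => simp [galoisConj_single]

theorem galoisConj_one (z : AddMonoidAlgebra K K) :
    galoisConj (1 : K ≃ₐ[ℚ] K) z = z := by
  induction z using AddMonoidAlgebra.induction_linear with
  | zero => simp
  | add f g hf hg => simp [hf, hg]
  | single y c => simp [galoisConj_single]

theorem galoisConj_ne_zero (σ : K ≃ₐ[ℚ] K) {z : AddMonoidAlgebra K K} (hz : z ≠ 0) :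
    galoisConj σ z ≠ 0 := fun h => hz <| by
  rw [← galoisConj_one z, ← inv_mul_cancel σ, ← galoisConj_galoisConj, h, map_zero]

theorem galoisConj_prod_galoisConj [FiniteDimensional ℚ K] (σ : K ≃ₐ[ℚ] K)
    (z : AddMonoidAlgebra K K) :
    galoisConj σ (∏ τ : K ≃ₐ[ℚ] K, galoisConj τ z) = ∏ τ : K ≃ₐ[ℚ] K, galoisConj τ z := by
  simp only [map_prod, galoisConj_galoisConj]
  exact Fintype.prod_equiv (Equiv.mulLeft σ) _ _ fun _ => rfl

theorem galoisConj_sum_galoisConj [FiniteDimensional ℚ K] (σ : K ≃ₐ[ℚ] K)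
    (z : AddMonoidAlgebra K K) :
    galoisConj σ (∑ τ : K ≃ₐ[ℚ] K, galoisConj τ z) = ∑ τ : K ≃ₐ[ℚ] K, galoisConj τ z := by
  simp only [map_sum, galoisConj_galoisConj]
  exact Fintype.sum_equiv (Equiv.mulLeft σ) _ _ fun _ => rfl

end galoisConj

/-- The evaluation map `K[K] → ℂ` sending the formal exponential of `x` to `exp x`. -/
noncomputable def expEval (K : Type*) [Field K] [Algebra K ℂ] : AddMonoidAlgebra K K →ₐ[K] ℂ :=
  AddMonoidAlgebra.lift K ℂ K
    (Complex.expMonoidHom.comp (AddMonoidHom.toMultiplicative (algebraMap K ℂ : K →+ ℂ)))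

theorem expEval_single {K : Type*} [Field K] [Algebra K ℂ] (x c : K) :
    expEval K (AddMonoidAlgebra.single x c) =
      algebraMap K ℂ c * Complex.exp (algebraMap K ℂ x) := by
  simp [expEval, Algebra.smul_def]

theorem expEval_apply {K : Type*} [Field K] [Algebra K ℂ] (z : AddMonoidAlgebra K K) :
    expEval K z =
      z.coeff.sum fun x c => algebraMap K ℂ c * Complex.exp (algebraMap K ℂ x) := by
  simp [expEval, AddMonoidAlgebra.lift_apply, Algebra.smul_def]

theorem expEval_injective {K : Type*} [Field K] [inst : Algebra ℚ K]
    [FiniteDimensional ℚ K] [IsGalois ℚ K] [Algebra K ℂ] :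
    Function.Injective (expEval K) := by
  have : CharZero K := charZero_of_injective_algebraMap (algebraMap ℚ K).injective
  classical
  rw [injective_iff_map_eq_zero]
  intro z hz
  by_contra hz0
  set y := ∏ τ : K ≃ₐ[ℚ] K, galoisConj τ z with hy
  have hy0 : y ≠ 0 := Finset.prod_ne_zero_iff.mpr fun τ _ => galoisConj_ne_zero τ hz0
  have hyE : expEval K y = 0 := by
    rw [hy, map_prod]
    exact Finset.prod_eq_zero (Finset.mem_univ 1) (by rw [galoisConj_one, hz])
  have hyG : ∀ σ : K ≃ₐ[ℚ] K, galoisConj σ y = y := fun σ => galoisConj_prod_galoisConj σ z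
  obtain ⟨γ, hγ⟩ : ∃ γ, y.coeff γ ≠ 0 := by
    by_contra! h
    exact hy0 (AddMonoidAlgebra.coeff_eq_zero.mp (Finsupp.ext h))
  set u := ∑ τ : K ≃ₐ[ℚ] K, galoisConj τ (AddMonoidAlgebra.single (-γ) (y.coeff γ)⁻¹) with hu
  have hv0 : (y * u).coeff 0 = Fintype.card (K ≃ₐ[ℚ] K) := by
    have h : ∀ τ : K ≃ₐ[ℚ] K, y.coeff (τ γ) = τ (y.coeff γ) := fun τ => by
      rw [← coeff_galoisConj_apply, hyG]
    have h' : ∀ τ : K ≃ₐ[ℚ] K, τ (y.coeff γ) ≠ 0 := fun τ => by simpa using hγ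
    rw [hu, Finset.mul_sum, AddMonoidAlgebra.coeff_sum, Finset.sum_apply']
    simp [galoisConj_single, AddMonoidAlgebra.coeff_mul_single_apply, h, h']
  have hvG : ∀ σ : K ≃ₐ[ℚ] K, galoisConj σ (y * u) = y * u := fun σ => by
    rw [map_mul, hyG, hu, galoisConj_sum_galoisConj]
  have hvE : expEval K (y * u) = 0 := by rw [map_mul, hyE, zero_mul]
  obtain ⟨N, hN0, hN⟩ := exists_integral_multiples ℤ ℚ
    ((y * u).coeff.support.image (y * u).coeff)
  refine sum_mul_cexp_ne_zero_of_isIntegral (N • (y * u)).coeff (fun x => ?_) (fun σ x => ?_)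
    (b := N * Fintype.card (K ≃ₐ[ℚ] K)) (by simp [hN0]) ?_ ?_
  · rw [AddMonoidAlgebra.coeff_smul_apply]
    by_cases hx : (y * u).coeff x = 0
    · simp [hx, isIntegral_zero]
    · exact hN _ (Finset.mem_image_of_mem _ (Finsupp.mem_support_iff.mpr hx))
  · rw [← coeff_galoisConj_apply, map_zsmul, hvG]
  · rw [AddMonoidAlgebra.coeff_smul_apply, hv0]
    simp
  · rw [← expEval_apply, map_zsmul, hvE, smul_zero]

theorem exists_isGalois_intermediateField_of_isAlgebraic {F L : Type*} [Field F] [Field L]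
    [CharZero F] [IsAlgClosed L] [Algebra F L] (s : Finset L) (hs : ∀ x ∈ s, IsAlgebraic F x) :
    ∃ K : IntermediateField F L, FiniteDimensional F K ∧ IsGalois F K ∧ ∀ x ∈ s, x ∈ K := by
  set P : F[X] := ∏ x ∈ s, minpoly F x with hP
  have hP0 : P ≠ 0 := Finset.prod_ne_zero_iff.mpr fun x hx => minpoly.ne_zero (hs x hx).isIntegral
  have : P.IsSplittingField F (IntermediateField.adjoin F (P.rootSet L)) :=
    IntermediateField.adjoin_rootSet_isSplittingField (IsAlgClosed.splits _)
  refine ⟨IntermediateField.adjoin F (P.rootSet L), IsSplittingField.finiteDimensional _ P, ?_,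
    fun x hx => IntermediateField.subset_adjoin _ _ ?_⟩
  · have := Normal.of_isSplittingField (F := F) (E := IntermediateField.adjoin F (P.rootSet L)) P
    exact ⟨⟩
  · rw [mem_rootSet]
    exact ⟨hP0, by rw [hP, map_prod]; exact Finset.prod_eq_zero hx (minpoly.aeval F x)⟩

/-- **Lindemann–Weierstrass**: exponentials of distinct algebraic numbers are linearly independent
over the algebraic numbers. -/
theorem eq_zero_of_sum_mul_cexp_eq_zero {ι : Type*} [Fintype ι] {v c : ι → ℂ}
    (hv : ∀ i, IsAlgebraic ℚ (v i)) (hc : ∀ i, IsAlgebraic ℚ (c i)) (hinj : Function.Injective v)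
    (h : ∑ i, c i * Complex.exp (v i) = 0) (i : ι) : c i = 0 := by
  classical
  obtain ⟨K, _, _, hK⟩ := exists_isGalois_intermediateField_of_isAlgebraic
    (Finset.univ.image v ∪ Finset.univ.image c) (F := ℚ) (by
      simp only [Finset.mem_union, Finset.mem_image, Finset.mem_univ, true_and]
      rintro _ (⟨i, rfl⟩ | ⟨i, rfl⟩)
      exacts [hv i, hc i])
  have hvK : ∀ i, v i ∈ K := fun i => hK _ (by simp)
  have hcK : ∀ i, c i ∈ K := fun i => hK _ (by simp)
  have hz : ∑ j, AddMonoidAlgebra.single (⟨v j, hvK j⟩ : K) (⟨c j, hcK j⟩ : K) = 0 := by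
    refine expEval_injective (inst := K.algebra') ?_
    rw [map_zero, map_sum, ← h]
    exact Finset.sum_congr rfl fun j _ => expEval_single _ _
  have hi := congrArg (fun z => z.coeff (⟨v i, hvK i⟩ : K)) hz
  simp only [AddMonoidAlgebra.coeff_sum, AddMonoidAlgebra.coeff_single, Finset.sum_apply',
    Finsupp.single_apply, Subtype.mk.injEq, hinj.eq_iff] at hi
  simpa using congrArg Subtype.val hi

theorem IsAlgebraic.eval_of_coeff {F L : Type*} [Field F] [Field L] [Algebra F L] {p : L[X]}
    (hp : ∀ k, IsAlgebraic F (p.coeff k)) {x : L} (hx : IsAlgebraic F x) :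
    IsAlgebraic F (p.eval x) := by
  rw [eval_eq_sum_range]
  exact (IsIntegral.sum _ fun k _ => ((hp k).mul (hx.pow k)).isIntegral).isAlgebraic

end LindemannWeierstrass


/-- Generalized Lindemann–Weierstrass: a nonzero solution `α` of
`∑ gᵢ(α) e^{αᵢ fᵢ(α)} = f(α)` (with pairwise distinct nonzero exponents and not all
coefficients zero) is transcendental, where the polynomials have algebraic coefficients. -/
theorem generalized_lindemann_weierstrass (m : ℕ)
    (f : Polynomial ℂ) (F G : Fin m → Polynomial ℂ)
    (hf : ∀ k, IsAlgebraic ℚ (f.coeff k))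
    (hF : ∀ i k, IsAlgebraic ℚ ((F i).coeff k))
    (hG : ∀ i k, IsAlgebraic ℚ ((G i).coeff k))
    (a : Fin m → ℂ) (ha0 : ∀ i, a i ≠ 0) (haalg : ∀ i, IsAlgebraic ℚ (a i))
    (α : ℂ) (hα : α ≠ 0)
    (heq : ∑ i, (G i).eval α * Complex.exp (a i * (F i).eval α) = f.eval α)
    (hexp_distinct : Function.Injective fun i => a i * (F i).eval α)
    (hexp_ne : ∀ i, a i * (F i).eval α ≠ 0)
    (hcoeff : ∃ i, (G i).eval α ≠ 0) :
    Transcendental ℚ α := by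
  intro hα_alg
  obtain ⟨i, hi⟩ := hcoeff
  refine hi (eq_zero_of_sum_mul_cexp_eq_zero
    (v := fun o : Option (Fin m) => o.elim 0 fun i => a i * (F i).eval α)
    (c := fun o => o.elim (-f.eval α) fun i => (G i).eval α) ?_ ?_ ?_ ?_ (some i))
  · rintro (_ | i)
    · exact isAlgebraic_zero
    · exact (haalg i).mul (.eval_of_coeff (hF i) hα_alg)
  · rintro (_ | i)
    · exact (IsAlgebraic.eval_of_coeff hf hα_alg).neg
    · exact .eval_of_coeff (hG i) hα_alg
  · rintro (_ | i) (_ | j) hij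
    · rfl
    · exact absurd hij.symm (hexp_ne j)
    · exact absurd hij (hexp_ne i)
    · exact congrArg some (hexp_distinct hij)
  · simp [Fintype.sum_option, heq]
end

section
/- Let f be a polynomial with rational coefficients. If α is a nonzero real number with -1 ≤ α ≤ 1 satisfying arcsin(α) = f(α) and f(α) ≠ 0, then α is transcendental. -/
open Polynomial

/-- A finite set of nonzero algebraic elements lies in the zero set of an integer polynomial with
nonzero constant term. -/
lemma exists_int_polynomial_forall_aeval_eq_zero {K : Type*} [Field K] [NumberField K]
    (S : Finset K) (hS : (0 : K) ∉ S) :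
    ∃ f : ℤ[X], f.eval 0 ≠ 0 ∧ ∀ u ∈ S, aeval u f = 0 := by
  have key (u : K) : ∃ f : ℤ[X], u ≠ 0 → f.eval 0 ≠ 0 ∧ aeval u f = 0 := by
    by_cases hu : u = 0
    · exact ⟨0, fun h => (h hu).elim⟩
    · have halg : IsAlgebraic ℤ u :=
        (IsFractionRing.isAlgebraic_iff ℤ ℚ K).mpr (Algebra.IsAlgebraic.isAlgebraic u)
      obtain ⟨f, hf, hfu⟩ := halg.exists_nonzero_coeff_and_aeval_eq_zero
        (mem_nonZeroDivisors_of_ne_zero hu)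
      exact ⟨f, fun _ => ⟨by rwa [← coeff_zero_eq_eval_zero], hfu⟩⟩
  choose f hf using key
  refine ⟨∏ u ∈ S, f u, ?_, fun u hu => ?_⟩
  · rw [eval_prod]
    exact Finset.prod_ne_zero_iff.mpr fun u hu => (hf u (ne_of_mem_of_not_mem hu hS)).1
  · rw [map_prod]
    exact Finset.prod_eq_zero hu (hf u (ne_of_mem_of_not_mem hu hS)).2

/-- Clearing denominators in the value of an integer polynomial. -/
lemma isIntegral_pow_mul_aeval {K : Type*} [CommRing K] {a : ℤ} {u : K}
    (hu : IsIntegral ℤ (a * u)) (g : ℤ[X]) {N : ℕ} (hN : g.natDegree ≤ N) :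
    IsIntegral ℤ ((a : K) ^ N * aeval u g) := by
  rw [aeval_eq_sum_range, Finset.mul_sum]
  refine IsIntegral.sum _ fun i hi => ?_
  have hiN : i ≤ N := (Nat.lt_succ_iff.mp (Finset.mem_range.mp hi)).trans hN
  have : (a : K) ^ N * g.coeff i • u ^ i =
      algebraMap ℤ K (a ^ (N - i) * g.coeff i) * (a * u) ^ i := by
    obtain ⟨k, rfl⟩ := Nat.exists_eq_add_of_le hiN
    simp only [add_tsub_cancel_left, zsmul_eq_mul, algebraMap_int_eq, eq_intCast]
    push_cast
    ring
  rw [this]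
  exact isIntegral_algebraMap.mul (hu.pow i)

/-- A Galois-invariant integral combination of values of an integer polynomial is an integer. -/
lemma exists_int_eq_pow_mul_sum_aeval {K : Type*} [Field K] [NumberField K] [IsGalois ℚ K]
    (S : Finset K) (F : K → ℤ) (hS : ∀ (σ : Gal(K/ℚ)) (u : K), u ∈ S → σ u ∈ S)
    (hF : ∀ (σ : Gal(K/ℚ)) (u : K), F (σ u) = F u)
    {a : ℤ} (ha : ∀ u ∈ S, IsIntegral ℤ (a * u)) (g : ℤ[X]) {N : ℕ} (hN : g.natDegree ≤ N) :
    ∃ M : ℤ, (a : K) ^ N * ∑ u ∈ S, F u * aeval u g = M := by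
  set x : K := (a : K) ^ N * ∑ u ∈ S, F u * aeval u g with hx
  have hint : IsIntegral ℤ x := by
    rw [hx, Finset.mul_sum]
    refine IsIntegral.sum _ fun u hu => ?_
    rw [mul_left_comm, ← eq_intCast (algebraMap ℤ K)]
    exact isIntegral_algebraMap.mul (isIntegral_pow_mul_aeval (ha u hu) g hN)
  have hfix (σ : Gal(K/ℚ)) : σ x = x := by
    simp only [hx, map_mul, map_pow, map_intCast, map_sum]
    congr 1
    refine Finset.sum_bij (fun u _ => σ u) (fun u hu => hS σ u hu) (fun _ _ _ _ h => σ.injective h)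
      (fun u hu => ⟨σ.symm u, hS σ.symm u hu, σ.apply_symm_apply u⟩) fun u _ => ?_
    rw [hF]
    congr 1
    exact (aeval_algHom_apply (σ.toAlgHom.restrictScalars ℤ) u g).symm
  obtain ⟨q, hq⟩ := (IsGalois.mem_range_algebraMap_iff_fixed x).mpr hfix
  have hqint : IsIntegral ℤ q := by
    rw [← hq] at hint
    exact (isIntegral_algebraMap_iff (algebraMap ℚ K).injective).mp hint
  obtain ⟨M, hM⟩ := IsIntegrallyClosed.isIntegral_iff.mp hqint
  exact ⟨M, by rw [← hq, ← hM]; simp⟩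

/-- A sum of exponentials of algebraic numbers with Galois-invariant integer coefficients and
nonzero constant coefficient does not vanish. -/
lemma sum_mul_exp_ne_zero_of_forall_galois {K : Type*} [Field K] [NumberField K] [IsGalois ℚ K]
    (φ : K →+* ℂ) (F : K →₀ ℤ) (h0 : F 0 ≠ 0) (hF : ∀ (σ : Gal(K/ℚ)) (u : K), F (σ u) = F u) :
    (F.sum fun u b => (b : ℂ) * Complex.exp (φ u)) ≠ 0 := by
  classical
  intro hsum
  set S := F.support.erase 0 with hSdef
  have hS (σ : Gal(K/ℚ)) (u : K) (hu : u ∈ S) : σ u ∈ S := by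
    simpa [hSdef, hF] using hu
  have hsum' : (F 0 : ℂ) + ∑ u ∈ S, (F u : ℂ) * Complex.exp (φ u) = 0 := by
    rw [Finsupp.sum, ← Finset.add_sum_erase _ _ (Finsupp.mem_support_iff.mpr h0)] at hsum
    simpa using hsum
  obtain ⟨f, hf0, hf⟩ := exists_int_polynomial_forall_aeval_eq_zero S (Finset.notMem_erase 0 _)
  obtain ⟨a, ha0, ha⟩ := exists_integral_multiples ℤ ℚ S
  simp_rw [zsmul_eq_mul] at ha
  obtain ⟨c, hc⟩ := LindemannWeierstrass.exp_polynomial_approx f hf0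
  set d := f.natDegree
  set B : ℝ := ∑ u ∈ S, |(F u : ℝ)|
  set C : ℝ := |(a : ℝ)| ^ d * |c|
  have hlim : Filter.Tendsto (fun n : ℕ => B * C * (C ^ n / n.factorial)) Filter.atTop (nhds 0) := by
    simpa using (FloorSemiring.tendsto_pow_div_factorial_atTop C).const_mul (B * C)
  obtain ⟨n₀, hn₀⟩ := Filter.eventually_atTop.mp (hlim.eventually_lt_const one_pos)
  obtain ⟨p, hp, hprime⟩ := Nat.exists_infinite_primes
    (n₀ + (eval 0 f).natAbs + a.natAbs + (F 0).natAbs + 2)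
  obtain ⟨n, hn, g, hg, happrox⟩ := hc p (by omega) hprime
  obtain ⟨M, hM⟩ := exists_int_eq_pow_mul_sum_aeval S F hS hF ha g
    (N := p * d) (hg.trans (Nat.sub_le _ _))
  have hpZ : Prime (p : ℤ) := Nat.prime_iff_prime_int.mp hprime
  have hndvd : ∀ m : ℤ, m ≠ 0 → m.natAbs < p → ¬ (p : ℤ) ∣ m := fun m hm hlt hdvd =>
    absurd (Nat.le_of_dvd (Int.natAbs_pos.mpr hm) (Int.natCast_dvd.mp hdvd)) (by omega)
  have hne : a ^ (p * d) * n * F 0 + p * M ≠ 0 := by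
    intro h
    have hdvd : (p : ℤ) ∣ a ^ (p * d) * n * F 0 :=
      (dvd_add_left (dvd_mul_right _ _)).mp (h ▸ dvd_zero _)
    rcases hpZ.dvd_or_dvd hdvd with h | h
    · rcases hpZ.dvd_or_dvd h with h | h
      · exact hndvd a ha0 (by omega) (hpZ.dvd_of_dvd_pow h)
      · exact hn h
    · exact hndvd _ h0 (by omega) h
  have hφ (u : K) : φ (aeval u g) = aeval (φ u) g := by
    simpa using (aeval_algHom_apply (φ.toIntAlgHom) u g).symm
  have hMC : (a : ℂ) ^ (p * d) * ∑ u ∈ S, (F u : ℂ) * aeval (φ u) g = M := by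
    simpa [hφ] using congrArg φ hM
  have hid : ((a ^ (p * d) * n * F 0 + p * M : ℤ) : ℂ) =
      -((a : ℂ) ^ (p * d) * ∑ u ∈ S, (F u : ℂ) *
        (n • Complex.exp (φ u) - p • aeval (φ u) g)) := by
    have h1 : ∑ u ∈ S, (F u : ℂ) * (n • Complex.exp (φ u) - p • aeval (φ u) g) =
        n * ∑ u ∈ S, (F u : ℂ) * Complex.exp (φ u) -
          p * ∑ u ∈ S, (F u : ℂ) * aeval (φ u) g := by
      rw [Finset.mul_sum, Finset.mul_sum, ← Finset.sum_sub_distrib]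
      refine Finset.sum_congr rfl fun u _ => ?_
      simp only [zsmul_eq_mul, nsmul_eq_mul]
      ring
    rw [h1]
    push_cast
    linear_combination (a : ℂ) ^ (p * d) * n * hsum' - p * hMC
  have hone : (1 : ℝ) ≤ ‖((a ^ (p * d) * n * F 0 + p * M : ℤ) : ℂ)‖ := by
    rw [Complex.norm_intCast]
    exact_mod_cast Int.one_le_abs hne
  have hterm (u : K) (hu : u ∈ S) :
      ‖n • Complex.exp (φ u) - p • aeval (φ u) g‖ ≤ |c| ^ p / (p - 1).factorial := by
    have hroot : φ u ∈ f.aroots ℂ := by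
      rw [mem_aroots]
      refine ⟨by rintro rfl; simp at hf0, ?_⟩
      have := aeval_algHom_apply (φ.toIntAlgHom) u f
      simpa [hf u hu] using this
    refine (happrox hroot).trans ?_
    gcongr ?_ / _
    exact (le_abs_self _).trans (abs_pow c p).le
  have hle : ‖((a ^ (p * d) * n * F 0 + p * M : ℤ) : ℂ)‖ ≤
      |(a : ℝ)| ^ (p * d) * (B * (|c| ^ p / (p - 1).factorial)) := by
    rw [hid, norm_neg, norm_mul, norm_pow, Complex.norm_intCast]
    gcongr
    rw [Finset.sum_mul]
    refine (norm_sum_le _ _).trans (Finset.sum_le_sum fun u hu => ?_)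
    rw [norm_mul, Complex.norm_intCast]
    gcongr
    exact hterm u hu
  have hlt := hn₀ (p - 1) (by omega)
  have heq : |(a : ℝ)| ^ (p * d) * (B * (|c| ^ p / (p - 1).factorial)) =
      B * C * (C ^ (p - 1) / (p - 1).factorial) := by
    have hC : |(a : ℝ)| ^ (p * d) * |c| ^ p = C * C ^ (p - 1) := by
      rw [mul_pow_sub_one hprime.ne_zero, mul_pow, ← pow_mul, mul_comm d]
    linear_combination B / (p - 1).factorial * hC
  linarith

open AddMonoidAlgebra in
/-- The exponential of a nonzero algebraic number is not a root of a nonzero integer polynomial. -/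
lemma aeval_exp_ne_zero {K : Type*} [Field K] [NumberField K] [IsGalois ℚ K]
    (φ : K →+* ℂ) {x : K} (hx : x ≠ 0) {Q : ℤ[X]} (hQ : Q ≠ 0) :
    aeval (Complex.exp (φ x)) Q ≠ 0 := by
  classical
  intro hroot
  let act (σ : Gal(K/ℚ)) : AddMonoidAlgebra ℤ K ≃+* AddMonoidAlgebra ℤ K :=
    mapDomainRingEquiv ℤ (σ : K ≃+ K)
  have act_single (σ : Gal(K/ℚ)) (u : K) (b : ℤ) : act σ (single u b) = single (σ u) b :=
    mapDomainRingEquiv_single ..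
  have coeff_act (σ : Gal(K/ℚ)) (y : AddMonoidAlgebra ℤ K) (u : K) :
      (act σ y).coeff (σ u) = y.coeff u := by
    simp [act]
  have act_act (σ τ : Gal(K/ℚ)) (y : AddMonoidAlgebra ℤ K) : act σ (act τ y) = act (σ * τ) y := by
    ext u
    obtain ⟨v, rfl⟩ := (σ * τ).surjective u
    rw [coeff_act, AlgEquiv.mul_apply, coeff_act, coeff_act]
  let expHom : Multiplicative K →* ℂ :=
    { toFun := fun u => Complex.exp (φ u.toAdd)
      map_one' := by simp
      map_mul' := by simp [Complex.exp_add] }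
  let E : AddMonoidAlgebra ℤ K →ₐ[ℤ] ℂ := AddMonoidAlgebra.lift ℤ ℂ K expHom
  let P : AddMonoidAlgebra ℤ K := aeval (single x 1) Q
  have hP : P ≠ 0 := by
    obtain ⟨k, hk⟩ : ∃ k, Q.coeff k ≠ 0 := by
      by_contra! h
      exact hQ (Polynomial.ext h)
    intro h
    have hcoeff : P.coeff (k • x) = Q.coeff k := by
      have hinj (i : ℕ) : i • x = k • x ↔ i = k := by simp [hx]
      simp only [P, aeval_eq_sum_range, single_pow, one_pow, smul_single, AddMonoidAlgebra.coeff_sum,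
        Finsupp.finsetSum_apply, coeff_single, Finsupp.single_apply, hinj]
      simp only [smul_eq_mul, mul_one, Finset.sum_ite_eq', Finset.mem_range]
      exact if_pos (Nat.lt_succ_of_le (le_natDegree_of_ne_zero hk))
    rw [h] at hcoeff
    exact hk (by simpa using hcoeff.symm)
  have hEP : E P = 0 := by
    have : E (single x 1) = Complex.exp (φ x) := by simp [E, expHom]
    rw [← aeval_algHom_apply, this, hroot]
  let R : AddMonoidAlgebra ℤ K := ∏ σ : Gal(K/ℚ), act σ P
  have hR : R ≠ 0 := Finset.prod_ne_zero_iff.mpr fun σ _ => (map_ne_zero_iff _ (act σ).injective).mpr hP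
  have hER : E R = 0 := by
    have h1 : act 1 P = P := by
      ext u
      exact coeff_act 1 P u
    rw [map_prod]
    exact Finset.prod_eq_zero (Finset.mem_univ 1) (by rw [h1, hEP])
  have hactR (τ : Gal(K/ℚ)) : act τ R = R := by
    simp only [R, map_prod, act_act]
    exact Fintype.prod_equiv (Equiv.mulLeft τ) _ _ fun σ => rfl
  have hRσ (σ : Gal(K/ℚ)) (u : K) : R.coeff (σ u) = R.coeff u := by
    conv_lhs => rw [← hactR σ]
    exact coeff_act σ R u
  obtain ⟨u, hu⟩ : ∃ u, R.coeff u ≠ 0 := by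
    by_contra! h
    exact hR (by ext u; simpa using h u)
  let T : AddMonoidAlgebra ℤ K := R * ∑ σ : Gal(K/ℚ), single (σ (-u)) 1
  have hactT (τ : Gal(K/ℚ)) : act τ T = T := by
    simp only [T, map_mul, map_sum, hactR, act_single]
    congr 1
    exact Fintype.sum_equiv (Equiv.mulLeft τ) _ _ fun σ => rfl
  have hT0 : T.coeff 0 ≠ 0 := by
    have : T.coeff 0 = Fintype.card Gal(K/ℚ) * R.coeff u := by
      simp [T, Finset.mul_sum, AddMonoidAlgebra.coeff_sum, coeff_mul_single_apply, hRσ]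
    rw [this]
    exact mul_ne_zero (by exact_mod_cast Fintype.card_ne_zero) hu
  have hET : E T = 0 := by simp [T, hER]
  refine sum_mul_exp_ne_zero_of_forall_galois φ T.coeff hT0 (fun σ v => ?_) ?_
  · conv_lhs => rw [← hactT σ]
    exact coeff_act σ T v
  · rw [← hET, AddMonoidAlgebra.lift_apply]
    simp [expHom]

/-- **Hermite–Lindemann theorem**: the exponential of a nonzero algebraic number is
transcendental. -/
theorem transcendental_cexp_of_isAlgebraic {x : ℂ} (hx : IsAlgebraic ℚ x) (hx0 : x ≠ 0) :
    Transcendental ℚ (Complex.exp x) := by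
  intro hexp
  have halg : IsAlgebraic ℤ (Complex.exp x) := (IsFractionRing.isAlgebraic_iff ℤ ℚ ℂ).mpr hexp
  obtain ⟨Q, hQ, hQx⟩ := halg
  let K := IntermediateField.adjoin ℚ ((minpoly ℚ x).rootSet ℂ)
  have : (minpoly ℚ x).IsSplittingField ℚ K :=
    IntermediateField.adjoin_rootSet_isSplittingField (IsAlgClosed.splits _)
  have : FiniteDimensional ℚ K := IsSplittingField.finiteDimensional K (minpoly ℚ x)
  have : IsGalois ℚ K :=
    IsGalois.of_separable_splitting_field (minpoly.irreducible hx.isIntegral).separable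
  have : NumberField K := ⟨⟩
  have hxK : x ∈ K := IntermediateField.subset_adjoin _ _
    (mem_rootSet.mpr ⟨minpoly.ne_zero hx.isIntegral, minpoly.aeval ℚ x⟩)
  exact aeval_exp_ne_zero (algebraMap K ℂ) (x := ⟨x, hxK⟩) (fun h => hx0 (congrArg Subtype.val h))
    hQ hQx

/-- The sine of a nonzero real algebraic number is transcendental. -/
theorem transcendental_sin_of_isAlgebraic {x : ℝ} (hx : IsAlgebraic ℚ x) (hx0 : x ≠ 0) :
    Transcendental ℚ (Real.sin x) := by
  intro hsin
  have hI : IsAlgebraic ℚ Complex.I := Complex.isIntegral_rat_I.isAlgebraic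
  have hsinC : IsAlgebraic ℚ (Complex.sin x) := by
    rw [← Complex.ofReal_sin]
    exact hsin.algebraMap
  have hcosC : IsAlgebraic ℚ (Complex.cos x) := by
    refine IsAlgebraic.of_pow two_pos ?_
    rw [Complex.cos_sq']
    exact isAlgebraic_one.sub (hsinC.pow 2)
  refine transcendental_cexp_of_isAlgebraic (x := x * Complex.I) (hx.algebraMap.mul hI)
    (mul_ne_zero (by exact_mod_cast hx0) Complex.I_ne_zero) ?_
  rw [Complex.exp_mul_I]
  exact hcosC.add (hsinC.mul hI)


/-- If `α` is a nonzero real number in `[-1, 1]` with `arcsin α = f α` and `f α ≠ 0`,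
then `α` is transcendental. -/
theorem transcendental_of_arcsin_eq_poly (f : Polynomial ℚ) (α : ℝ) (hα : α ≠ 0)
    (h₁ : -1 ≤ α) (h₂ : α ≤ 1)
    (heq : Real.arcsin α = Polynomial.aeval α f)
    (hf : Polynomial.aeval α f ≠ 0) :
    Transcendental ℚ α := by
  intro halg
  have hfalg : IsAlgebraic ℚ (aeval α f) :=
    IsIntegral.isAlgebraic <|
      adjoin_le_integralClosure halg.isIntegral (aeval_mem_adjoin_singleton ℚ α)
  refine transcendental_sin_of_isAlgebraic hfalg hf ?_
  rwa [← heq, Real.sin_arcsin h₁ h₂]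
end
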